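/- arXiv:1902.05634 — 6 statements merged into one kernel-verified Lean document; each statement's English description precedes it below -/
import Mathlib

section
/- Fix d ≥ 1 and n ≥ 1. For functions f, g : (Fin n → ZMod d) → ZMod d and square matrices E, F over ZMod d indexed by Fin n, the product U_{f,E} · U_{g,F} equals U_{h, E·F}, where h(x) = f(F·x) + g(x). -/
open Matrix

/-- The phase `ω^a = exp(2πi·a.val/d)` for `a : ZMod d`. -/
noncomputable def zmodPhase (d : ℕ) (a : ZMod d) : ℂ :=
  Complex.exp (2 * Real.pi * Complex.I * a.val / d)

/-- The matrix `U_{f,E} = Σ_x ω^{f(x)} |Ex⟩⟨x|`. -/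
noncomputable def Umat {d n : ℕ} (f : (Fin n → ZMod d) → ZMod d)
    (E : Matrix (Fin n) (Fin n) (ZMod d)) :
    Matrix (Fin n → ZMod d) (Fin n → ZMod d) ℂ :=
  Matrix.of fun y x => if y = E.mulVec x then zmodPhase d (f x) else 0

theorem zmodPhase_add_aux (d : ℕ) [NeZero d] (a b : ZMod d) :
    zmodPhase d (a + b) = zmodPhase d a * zmodPhase d b := by
  have h : ∀ c : ZMod d, zmodPhase d c = ZMod.stdAddChar c := fun c => by
    rw [ZMod.stdAddChar_apply, ZMod.toCircle_apply, zmodPhase]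
  rw [h, h, h, AddChar.map_add_eq_mul]

theorem Umat_mul (d n : ℕ) [NeZero d] (hd : 1 ≤ d) (hn : 1 ≤ n)
    (f g : (Fin n → ZMod d) → ZMod d)
    (E F : Matrix (Fin n) (Fin n) (ZMod d)) :
    Umat f E * Umat g F = Umat (fun x => f (F.mulVec x) + g x) (E * F) := by
  ext y x
  rw [Matrix.mul_apply, Finset.sum_eq_single (F.mulVec x)]
  · simp only [Umat, Matrix.of_apply, Matrix.mulVec_mulVec, if_true, zmodPhase_add_aux, ite_mul,
      zero_mul]
  · intro z _ hz
    simp [Umat, hz]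
  · intro h
    exact absurd (Finset.mem_univ _) h
end

section
/- Fix d ≥ 2. For any unit l ∈ (ZMod d)ˣ, P_l · X · P_{l⁻¹} = X^{l.val}, where l.val is the canonical representative of l in {0,…,d−1}. -/
open Matrix

/-- The qudit Pauli `X` gate: `X(y,x) = 1` iff `y = x + 1`. -/
def Xgate (d : ℕ) : Matrix (ZMod d) (ZMod d) ℂ :=
  Matrix.of fun y x => if y = x + 1 then 1 else 0

/-- The qudit Pauli `Z` gate: diagonal with `Z(x,x) = ω^x`. -/
noncomputable def Zgate (d : ℕ) : Matrix (ZMod d) (ZMod d) ℂ :=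
  Matrix.of fun y x => if y = x then zmodPhase d x else 0

/-- The qudit phase gate `S`: diagonal with `S(x,x) = ω^(x²)`. -/
noncomputable def Sgate (d : ℕ) : Matrix (ZMod d) (ZMod d) ℂ :=
  Matrix.of fun y x => if y = x then zmodPhase d (x ^ 2) else 0

/-- The qudit magic gate `M`: diagonal with `M(x,x) = ω^(x³)`. -/
noncomputable def Mgate (d : ℕ) : Matrix (ZMod d) (ZMod d) ℂ :=
  Matrix.of fun y x => if y = x then zmodPhase d (x ^ 3) else 0

/-- The product operator `P_l`: `P_l(y,x) = 1` iff `y = l·x`. -/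
def Pgate (d : ℕ) (l : (ZMod d)ˣ) : Matrix (ZMod d) (ZMod d) ℂ :=
  Matrix.of fun y x => if y = (l : ZMod d) * x then 1 else 0

theorem Xgate_pow_aux (d : ℕ) [NeZero d] (n : ℕ) :
    Xgate d ^ n = Matrix.of fun y x => if y = x + (n : ZMod d) then 1 else 0 := by
  induction n with
  | zero => ext y x; simp [Matrix.one_apply]
  | succ k ih =>
    rw [pow_succ, ih]
    ext y x
    simp [Matrix.mul_apply, Xgate, add_assoc, add_comm (1 : ZMod d)]

theorem Pgate_conj_Xgate (d : ℕ) [NeZero d] (hd : 2 ≤ d) (l : (ZMod d)ˣ) :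
    Pgate d l * Xgate d * Pgate d l⁻¹ = Xgate d ^ (l : ZMod d).val := by
  rw [Xgate_pow_aux]
  ext y x
  simp [Matrix.mul_apply, Pgate, Xgate, mul_add]
end

section
/- Fix d ≥ 2. For any unit l ∈ (ZMod d)ˣ, P_l · Z · P_{l⁻¹} = Z^{(l⁻¹).val}, where (l⁻¹).val is the canonical representative of l⁻¹ in {0,…,d−1}. -/
open Matrix

theorem zmodPhase_eq_char (d : ℕ) [NeZero d] (a : ZMod d) :
    zmodPhase d a = ZMod.stdAddChar a := by
  rw [ZMod.stdAddChar_apply, ZMod.toCircle_apply]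
  rfl

theorem zmodPhase_mul_pow (d : ℕ) [NeZero d] (a x : ZMod d) :
    zmodPhase d (a * x) = zmodPhase d x ^ a.val := by
  rw [zmodPhase_eq_char, zmodPhase_eq_char, ← AddChar.map_nsmul_eq_pow, nsmul_eq_mul,
    ZMod.natCast_zmod_val]

theorem Zgate_eq_diagonal (d : ℕ) : Zgate d = Matrix.diagonal (zmodPhase d) := by
  ext y x
  by_cases h : y = x
  · subst h; simp [Zgate]
  · simp [Zgate, h]

theorem Pgate_conj_Zgate (d : ℕ) [NeZero d] (hd : 2 ≤ d) (l : (ZMod d)ˣ) :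
    Pgate d l * Zgate d * Pgate d l⁻¹ = Zgate d ^ ((l⁻¹ : (ZMod d)ˣ) : ZMod d).val := by
  rw [Zgate_eq_diagonal, Matrix.diagonal_pow]
  ext y x
  rw [Matrix.mul_apply]
  simp only [Matrix.mul_diagonal, Pgate, Matrix.of_apply]
  rw [Finset.sum_eq_single (((l⁻¹ : (ZMod d)ˣ) : ZMod d) * x)]
  · by_cases h : y = x
    · subst h
      simp [zmodPhase_mul_pow]
    · simp [h]
  · intro b _ hb
    simp [hb]
  · simp
end

section
/- Let d be a prime with d > 3. Define f : (Fin 3 → ZMod d) → ZMod d by f(x) = 24⁻¹·((x₁+x₂+x₃)³ + (x₁−x₂−x₃)³ + (x₂−x₁−x₃)³ + (x₃−x₁−x₂)³). Then the diagonal complex matrix with entries ω^{f(x)} at (x,x), indexed by Fin 3 → ZMod d, equals the CCZ gate, i.e. the diagonal matrix with entries ω^{x₁·x₂·x₃} at (x,x). -/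
open Matrix

theorem four_M_implementation_of_CCZ (d : ℕ) [Fact (Nat.Prime d)] (hd : 3 < d) :
    let f : (Fin 3 → ZMod d) → ZMod d := fun x =>
      (24 : ZMod d)⁻¹ * ((x 0 + x 1 + x 2) ^ 3 + (x 0 - x 1 - x 2) ^ 3 +
        (x 1 - x 0 - x 2) ^ 3 + (x 2 - x 0 - x 1) ^ 3)
    Matrix.diagonal (fun x : Fin 3 → ZMod d => zmodPhase d (f x)) =
      Matrix.diagonal (fun x : Fin 3 → ZMod d => zmodPhase d (x 0 * x 1 * x 2)) := by
  intro f
  have hp : Nat.Prime d := Fact.out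
  have h24 : (24 : ZMod d) ≠ 0 := by
    intro h
    have h' : ((24 : ℕ) : ZMod d) = 0 := by exact_mod_cast h
    rw [ZMod.natCast_eq_zero_iff] at h'
    have h2 : d ∣ 2 ^ 3 * 3 := by simpa using h'
    rcases hp.dvd_mul.1 h2 with h3 | h3
    · have := Nat.le_of_dvd (by norm_num) (hp.dvd_of_dvd_pow h3)
      omega
    · have := Nat.le_of_dvd (by norm_num) h3
      omega
  have hf : ∀ x, f x = x 0 * x 1 * x 2 := by
    intro x
    have h : f x = (24 : ZMod d)⁻¹ * (24 * (x 0 * x 1 * x 2)) := by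
      simp only [f]
      congr 1
      ring
    rw [h, inv_mul_cancel_left₀ h24]
  simp only [hf]
end

section
/- Let d be a prime with d > 3 and n ≥ 1. For every symmetric tensor S : Fin n → Fin n → Fin n → ZMod d (invariant under all permutations of its three indices), there exist m ∈ ℕ, an n × m matrix A over ZMod d, and λ ∈ (ZMod d)^m such that S_{α,β,γ} = Σ_{j=1}^m λ_j·A_{α,j}·A_{β,j}·A_{γ,j} for all α, β, γ. That is, every symmetric signature tensor admits an implementation. -/
theorem symmetric_tensor_has_implementation (d : ℕ) [Fact (Nat.Prime d)]
    (hd : 3 < d) (n : ℕ) (hn : 1 ≤ n)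
    (S : Fin n → Fin n → Fin n → ZMod d)
    (hS : ∀ α β γ, S α β γ = S α γ β ∧ S α β γ = S β α γ ∧
      S α β γ = S β γ α ∧ S α β γ = S γ α β ∧ S α β γ = S γ β α) :
    ∃ (m : ℕ) (A : Matrix (Fin n) (Fin m) (ZMod d)) (lam : Fin m → ZMod d),
      ∀ α β γ, S α β γ = ∑ j, lam j * A α j * A β j * A γ j := by
  have h6 : (6 : ZMod d) ≠ 0 := by
    intro h
    have h' : ((6 : ℕ) : ZMod d) = 0 := by exact_mod_cast h
    rw [ZMod.natCast_eq_zero_iff] at h'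
    have hp : Nat.Prime d := Fact.out
    have hle := Nat.le_of_dvd (by norm_num) h'
    interval_cases d <;> revert h' hp <;> decide
  let e : Fin n → Fin n → ZMod d := fun i a => if a = i then 1 else 0
  let B : Fin n → (Fin n × Fin n × Fin n) × Fin 7 → ZMod d := fun a p =>
    ![e p.1.1 a + e p.1.2.1 a + e p.1.2.2 a, e p.1.1 a + e p.1.2.1 a,
      e p.1.1 a + e p.1.2.2 a, e p.1.2.1 a + e p.1.2.2 a,
      e p.1.1 a, e p.1.2.1 a, e p.1.2.2 a] p.2
  let l : (Fin n × Fin n × Fin n) × Fin 7 → ZMod d := fun p =>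
    S p.1.1 p.1.2.1 p.1.2.2 * 6⁻¹ * ![1, -1, -1, -1, 1, 1, 1] p.2
  let f := Fintype.equivFin ((Fin n × Fin n × Fin n) × Fin 7)
  refine ⟨_, fun a j => B a (f.symm j), fun j => l (f.symm j), fun α β γ => ?_⟩
  rw [Equiv.sum_comp f.symm (fun p => l p * B α p * B β p * B γ p)]
  have key : ∀ a b c, ∑ i, ∑ j, ∑ k, S i j k * (e i a * e j b * e k c) = S a b c := by
    intro a b c
    simp [e, ← ite_and, mul_ite]
    simp [ite_and]
  have h1 : ∀ i j k, ∑ t, l ((i, j, k), t) * B α ((i, j, k), t) * B β ((i, j, k), t)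
      * B γ ((i, j, k), t) = 6⁻¹ * (S i j k * (e i α * e j β * e k γ)
        + S i j k * (e i α * e j γ * e k β) + S i j k * (e i β * e j α * e k γ)
        + S i j k * (e i β * e j γ * e k α) + S i j k * (e i γ * e j α * e k β)
        + S i j k * (e i γ * e j β * e k α)) := by
    intro i j k
    simp only [l, B, Fin.sum_univ_succ, Fin.sum_univ_zero, Matrix.cons_val_zero,
      Matrix.cons_val_succ]
    ring
  rw [Fintype.sum_prod_type]
  simp only [Fintype.sum_prod_type, h1]
  simp only [← Finset.mul_sum, Finset.sum_add_distrib, key]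
  obtain ⟨a1, a2, a3, a4, a5⟩ := hS α β γ
  rw [← a1, ← a2, ← a3, ← a4, ← a5]
  field_simp
  ring
end

section
/- Let R be a commutative ring, A an n × m matrix over R with m ≥ 2, λ ∈ R^m, and a ≠ b column indices. Let z = c_b − c_a (the difference of columns b and a of A) and suppose y ∈ R^m satisfies y_a − y_b = 1 and Δ_{α,β,γ} = 0 for all α, β, γ, where Δ_{α,β,γ} = Σ_{j=1}^m λ_j·(A_{α,j}A_{β,j}z_γ y_j + A_{β,j}A_{γ,j}z_α y_j + A_{γ,j}A_{α,j}z_β y_j + A_{α,j}z_β z_γ y_j² + A_{β,j}z_γ z_α y_j² + A_{γ,j}z_α z_β y_j² + z_α z_β z_γ y_j³). Then there exist an n × (m−1) matrix A″ over R and λ″ ∈ R^{m−1} whose signature tensor equals the signature tensor of (A, λ). -/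
theorem dam_correctness {R : Type*} [CommRing R] {n m : ℕ} (hm : 2 ≤ m)
    (A : Matrix (Fin n) (Fin m) R) (lam : Fin m → R) (a b : Fin m) (hab : a ≠ b)
    (y : Fin m → R) (hy : y a - y b = 1)
    (hΔ : ∀ α β γ : Fin n,
      (∑ j, lam j *
        (A α j * A β j * (A γ b - A γ a) * y j +
          A β j * A γ j * (A α b - A α a) * y j +
          A γ j * A α j * (A β b - A β a) * y j +
          A α j * (A β b - A β a) * (A γ b - A γ a) * y j ^ 2 +
          A β j * (A γ b - A γ a) * (A α b - A α a) * y j ^ 2 +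
          A γ j * (A α b - A α a) * (A β b - A β a) * y j ^ 2 +
          (A α b - A α a) * (A β b - A β a) * (A γ b - A γ a) * y j ^ 3)) = 0) :
    ∃ (A'' : Matrix (Fin n) (Fin (m - 1)) R) (lam'' : Fin (m - 1) → R),
      ∀ α β γ : Fin n,
        (∑ j, lam'' j * A'' α j * A'' β j * A'' γ j) =
          ∑ j, lam j * A α j * A β j * A γ j := by
  obtain ⟨k, rfl⟩ : ∃ k, m = k + 1 := ⟨m - 1, by omega⟩
  obtain ⟨c, rfl⟩ := Fin.exists_succAbove_eq hab.symm
  change ∃ (A'' : Matrix (Fin n) (Fin k) R) (lam'' : Fin k → R), ∀ α β γ : Fin n,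
        (∑ j, lam'' j * A'' α j * A'' β j * A'' γ j) =
          ∑ j, lam j * A α j * A β j * A γ j
  set b := a.succAbove c with hb
  let P : Fin n → Fin (k + 1) → R := fun i j => A i j + (A i b - A i a) * y j
  have hP : ∀ i, P i a = P i b := by
    intro i
    simp only [P]
    linear_combination (A i b - A i a) * hy
  refine ⟨fun i j => P i (a.succAbove j),
    fun j => lam (a.succAbove j) + if j = c then lam a else 0, ?_⟩
  intro α β γ
  have h1 : ∑ j, lam j * P α j * P β j * P γ j = ∑ j, lam j * A α j * A β j * A γ j := by
    rw [← sub_eq_zero, ← Finset.sum_sub_distrib, ← hΔ α β γ]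
    refine Finset.sum_congr rfl fun j _ => ?_
    simp only [P]
    ring
  rw [← h1, Fin.sum_univ_succAbove _ a, hP, hP, hP]
  simp only [add_mul, ite_mul, zero_mul, Finset.sum_add_distrib, Finset.sum_ite_eq',
    Finset.sum_ite_eq, Finset.mem_univ, if_true]
  rw [add_comm]
end
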